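/- arXiv:1008.3408 — 2 statements merged into one kernel-verified Lean document; each statement's English description precedes it below -/
import Mathlib

section
/- Let F be a finite field with q elements and m, n positive integers with m ≤ n. A pmf f on F^{m×n} is the uniform distribution (f(N) = q^{-mn} for all N) if and only if for every matrix M ∈ F^{m×n} of rank m and every K ∈ F^{m×m}, ∑_{N ∈ F^{m×n} with M·Nᵀ = K} f(N) = q^{-m²} (i.e. the product M·Ñᵀ is uniformly distributed over F^{m×m} for every full-rank M). -/
open Matrix

/-- `f` is a probability mass function on a finite type `X`. -/
def IsPmf {X : Type*} [Fintype X] (f : X → ℝ) : Prop :=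
  (∀ x, 0 ≤ f x) ∧ ∑ x, f x = 1

lemma aux_card {F : Type*} [Fintype F] (m n : ℕ) :
    Fintype.card (Matrix (Fin m) (Fin n) F) = Fintype.card F ^ (m * n) := by
  have : Fintype.card (Matrix (Fin m) (Fin n) F) = Fintype.card (Fin m → Fin n → F) :=
    Fintype.card_congr (Equiv.refl _)
  rw [this]
  simp [mul_comm m n, pow_mul]

lemma aux_extend {F V : Type*} [Field F] [AddCommGroup V] [Module F V] [FiniteDimensional F V]
    (m : ℕ) (hm : m ≤ Module.finrank F V) (d : ℕ) :
    ∀ S : Submodule F V, Module.finrank F S + d = m →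
      ∃ W : Submodule F V, S ≤ W ∧ Module.finrank F W = m := by
  induction d with
  | zero => intro S hS; exact ⟨S, le_rfl, by simpa using hS⟩
  | succ d ih =>
    intro S hS
    have hne : S ≠ ⊤ := by
      rintro rfl
      rw [finrank_top] at hS
      omega
    obtain ⟨v, hv⟩ : ∃ v, v ∉ S := by
      by_contra! h
      exact hne (by ext x; simp [h x])
    have hlt : S < S ⊔ Submodule.span F {v} := by
      refine lt_of_le_of_ne le_sup_left ?_
      intro h
      apply hv
      rw [h]
      exact (le_sup_right : Submodule.span F {v} ≤ S ⊔ Submodule.span F {v})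
        (Submodule.mem_span_singleton_self v)
    have h1 := Submodule.finrank_lt_finrank_of_lt hlt
    have h2 := Submodule.finrank_add_le_finrank_add_finrank S (Submodule.span F {v})
    have h3 : Module.finrank F (Submodule.span F {v}) ≤ 1 := by
      have := finrank_span_le_card (R := F) ({v} : Set V)
      simpa using this
    obtain ⟨W, hW, hW'⟩ := ih (S ⊔ Submodule.span F {v}) (by omega)
    exact ⟨W, le_sup_left.trans hW, hW'⟩

lemma aux_factor {F : Type*} [Field F] {m n : ℕ} (hmn : m ≤ n) (B : Matrix (Fin m) (Fin n) F) :
    ∃ (A : Matrix (Fin m) (Fin m) F) (M : Matrix (Fin m) (Fin n) F), M.rank = m ∧ B = A * M := by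
  have hS : Module.finrank F (Submodule.span F (Set.range B.row)) ≤ m := by
    have := finrank_range_le_card (R := F) B.row
    rw [Fintype.card_fin] at this
    exact this
  obtain ⟨W, hW, hWm⟩ := aux_extend (F := F) (V := Fin n → F) m (by simpa using hmn)
    (m - Module.finrank F (Submodule.span F (Set.range B.row)))
    (Submodule.span F (Set.range B.row)) (by omega)
  let b := Module.finBasisOfFinrankEq F W hWm
  have hB : ∀ i, B i ∈ W := fun i => hW (Submodule.subset_span ⟨i, rfl⟩)
  refine ⟨Matrix.of fun i k => b.repr ⟨B i, hB i⟩ k, Matrix.of fun k => (b k : Fin n → F), ?_, ?_⟩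
  · have : LinearIndependent F (Matrix.of fun k => (b k : Fin n → F)).row :=
      b.linearIndependent.map' W.subtype (Submodule.ker_subtype W)
    simpa using this.rank_matrix
  · ext i j
    have h := congrArg (fun w : W => (w : Fin n → F) j) (b.sum_repr ⟨B i, hB i⟩)
    simp only [Matrix.mul_apply, Matrix.of_apply]
    refine Eq.trans h.symm ?_
    simp only [Submodule.coe_sum, Submodule.coe_smul, Finset.sum_apply, Pi.smul_apply, smul_eq_mul]

/-- character sum orthogonality -/
lemma aux_orth {F : Type*} [Field F] [Fintype F] [DecidableEq F] {m n : ℕ} (ψ : AddChar F ℂ)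
    (hψ : ψ ≠ 1) (D : Matrix (Fin m) (Fin n) F) (hD : D ≠ 0) :
    ∑ B : Matrix (Fin m) (Fin n) F, ψ (Matrix.trace (B * Dᵀ)) = 0 := by
  let φ : Matrix (Fin m) (Fin n) F →+ F :=
    { toFun := fun B => Matrix.trace (B * Dᵀ)
      map_zero' := by simp
      map_add' := by intro x y; simp [Matrix.add_mul] }
  have hne : ψ.compAddMonoidHom φ ≠ 0 := by
    intro h
    apply hψ
    obtain ⟨i, j, hij⟩ : ∃ i j, D i j ≠ 0 := by
      by_contra! h
      exact hD (by ext i j; simp [h i j])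
    ext c
    have := DFunLike.congr_fun h (Matrix.single i j (c * (D i j)⁻¹))
    have ht : Matrix.trace (Matrix.single i j (c * (D i j)⁻¹) * Dᵀ) = c := by
      rw [Matrix.trace_single_mul]
      simp [hij]
    simpa [φ, AddChar.compAddMonoidHom_apply, ht] using this
  have := AddChar.sum_eq_zero_iff_ne_zero.mpr hne
  simpa [φ, AddChar.compAddMonoidHom_apply] using this

theorem stmt8 {F : Type*} [Field F] [Fintype F] [DecidableEq F] (q m n : ℕ)
    (hq : Fintype.card F = q) (hm : 0 < m) (hmn : m ≤ n)
    (f : Matrix (Fin m) (Fin n) F → ℝ) (hf : IsPmf f) :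
    (∀ N : Matrix (Fin m) (Fin n) F, f N = ((q : ℝ) ^ (m * n))⁻¹) ↔
      (∀ M : Matrix (Fin m) (Fin n) F, M.rank = m →
        ∀ K : Matrix (Fin m) (Fin m) F,
          ∑ N ∈ Finset.univ.filter
              fun N : Matrix (Fin m) (Fin n) F => M * N.transpose = K, f N
            = ((q : ℝ) ^ (m * m))⁻¹) := by
  have hq0 : (q : ℝ) ≠ 0 := by
    rw [← hq]; exact_mod_cast Fintype.card_ne_zero
  constructor
  · intro h M hM K
    obtain ⟨P, hP⟩ : ∃ P : Matrix (Fin n) (Fin m) F, M * P = 1 := by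
      rw [← Matrix.mulVec_surjective_iff_exists_right_inverse]
      have : LinearMap.range M.mulVecLin = ⊤ := by
        apply Submodule.eq_top_of_finrank_eq
        rw [← Matrix.rank, hM]; simp
      exact LinearMap.range_eq_top.mp this
    have hc : ∀ K : Matrix (Fin m) (Fin m) F,
        ∑ N ∈ Finset.univ.filter
              fun N : Matrix (Fin m) (Fin n) F => M * N.transpose = K, f N
        = ∑ N ∈ Finset.univ.filter
              fun N : Matrix (Fin m) (Fin n) F => M * N.transpose = 0, f N := by
      intro K
      refine Finset.sum_bij' (fun N _ => N - (P * K)ᵀ) (fun N _ => N + (P * K)ᵀ) ?_ ?_ ?_ ?_ ?_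
      · intro N hN
        simp only [Finset.mem_filter, Finset.mem_univ, true_and] at hN ⊢
        rw [Matrix.transpose_sub, Matrix.transpose_transpose, Matrix.mul_sub, ← Matrix.mul_assoc,
          hP, hN]; simp
      · intro N hN
        simp only [Finset.mem_filter, Finset.mem_univ, true_and] at hN ⊢
        rw [Matrix.transpose_add, Matrix.transpose_transpose, Matrix.mul_add, ← Matrix.mul_assoc,
          hP, hN]; simp
      · intros; simp
      · intros; simp
      · intros; rw [h, h]
    have hs := Finset.sum_fiberwise (Finset.univ) (fun N : Matrix (Fin m) (Fin n) F => M * Nᵀ) f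
    rw [hf.2] at hs
    rw [Finset.sum_congr rfl (fun K _ => hc K)] at hs
    rw [hc K]
    simp only [Finset.sum_const, Finset.card_univ, aux_card, hq,
      nsmul_eq_mul] at hs
    push_cast at hs
    exact eq_inv_of_mul_eq_one_right hs
  · intro h N0
    obtain ⟨ψ, hψ⟩ : ∃ ψ : AddChar F ℂ, ψ ≠ 1 := by
      obtain ⟨ψ, hψ⟩ := AddChar.exists_apply_ne_zero.mpr (one_ne_zero : (1 : F) ≠ 0)
      exact ⟨ψ, fun h => hψ (by simp [h])⟩
    have hhat : ∀ B : Matrix (Fin m) (Fin n) F, B ≠ 0 →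
        ∑ N, (f N : ℂ) * ψ (Matrix.trace (B * Nᵀ)) = 0 := by
      intro B hB
      obtain ⟨A, M, hM, rfl⟩ := aux_factor hmn B
      have hA : Aᵀ ≠ 0 := by
        intro hA
        apply hB
        rw [Matrix.transpose_eq_zero.mp hA]; simp
      rw [← Finset.sum_fiberwise (Finset.univ) (fun N : Matrix (Fin m) (Fin n) F => M * Nᵀ)]
      have : ∀ K : Matrix (Fin m) (Fin m) F,
          ∑ N ∈ Finset.univ.filter
              (fun N : Matrix (Fin m) (Fin n) F => M * Nᵀ = K),
              (f N : ℂ) * ψ (Matrix.trace (A * M * Nᵀ))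
          = (((q : ℝ) ^ (m * m))⁻¹ : ℝ) * ψ (Matrix.trace (K * Aᵀᵀ)) := by
        intro K
        rw [← h M hM K, Complex.ofReal_sum, Finset.sum_mul]
        refine Finset.sum_congr rfl fun N hN => ?_
        simp only [Finset.mem_filter, Finset.mem_univ, true_and] at hN
        rw [Matrix.mul_assoc, hN, Matrix.transpose_transpose, Matrix.trace_mul_comm]
      rw [Finset.sum_congr rfl (fun K _ => this K), ← Finset.mul_sum, aux_orth ψ hψ _ hA, mul_zero]
    have e1 : ∑ B : Matrix (Fin m) (Fin n) F, ∑ N, (f N : ℂ) * ψ (Matrix.trace (B * (N - N0)ᵀ))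
        = 1 := by
      rw [Finset.sum_eq_single 0]
      · simp only [Matrix.zero_mul, Matrix.trace_zero, AddChar.map_zero_eq_one, mul_one]
        exact_mod_cast hf.2
      · intro B _ hB
        have := hhat B hB
        calc _ = (∑ N, (f N : ℂ) * ψ (Matrix.trace (B * Nᵀ))) * ψ (-(Matrix.trace (B * N0ᵀ))) := by
              rw [Finset.sum_mul]
              refine Finset.sum_congr rfl fun N _ => ?_
              rw [mul_assoc, ← AddChar.map_add_eq_mul, Matrix.transpose_sub, Matrix.mul_sub,
                Matrix.trace_sub, sub_eq_add_neg]
          _ = 0 := by rw [this, zero_mul]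
      · simp
    rw [Finset.sum_comm, Finset.sum_eq_single N0] at e1
    · simp only [sub_self, Matrix.transpose_zero, Matrix.mul_zero, Matrix.trace_zero,
        AddChar.map_zero_eq_one, mul_one, Finset.sum_const, Finset.card_univ, aux_card, hq, nsmul_eq_mul] at e1
      have e2 : (q : ℝ) ^ (m * n) * f N0 = 1 := by exact_mod_cast e1
      exact eq_inv_of_mul_eq_one_right e2
    · intro N _ hN
      rw [← Finset.mul_sum, aux_orth ψ hψ _ (sub_ne_zero.mpr hN), mul_zero]
    · simp
end

section
/- Let F be a finite field with q elements and k, m, n positive integers with k ≤ m ≤ n. (a) Every k-dense subset 𝒜 ⊆ F^{m×n} satisfies |𝒜| ≥ q^{kn}. (b) A subset 𝒜 ⊆ F^{m×n} with |𝒜| = q^{kn} is k-dense if and only if 𝒜 is an (m,n,k) MRD code. In particular, the minimum size of a k-dense subset of F^{m×n} is q^{kn} when m ≤ n. -/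
open Matrix

/-- A set `𝒜 ⊆ F^{m×n}` is `k`-dense if `M𝒜 = F^{k×n}` for every full-rank
`M ∈ F^{k×m}`. -/
def IsKDense {F : Type*} [Field F] [Fintype F] {m n : ℕ} (k : ℕ)
    (𝒜 : Set (Matrix (Fin m) (Fin n) F)) : Prop :=
  ∀ M : Matrix (Fin k) (Fin m) F, M.rank = k →
    (fun A => M * A) '' 𝒜 = (Set.univ : Set (Matrix (Fin k) (Fin n) F))

/-- The rank distance of a set of matrices. -/
noncomputable def rankDist {F : Type*} [Field F] [Fintype F] {m n : ℕ}
    (𝒜 : Set (Matrix (Fin m) (Fin n) F)) : ℕ :=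
  sInf {r : ℕ | ∃ X ∈ 𝒜, ∃ Y ∈ 𝒜, X ≠ Y ∧ (X - Y).rank = r}

/-- An `(m,n,k)` MRD code over the field `F` with `q` elements. -/
def IsMRD (q k : ℕ) {F : Type*} [Field F] [Fintype F] {m n : ℕ}
    (𝒜 : Set (Matrix (Fin m) (Fin n) F)) : Prop :=
  𝒜.ncard = q ^ (k * max m n) ∧ rankDist 𝒜 = min m n - k + 1

theorem aux_exists_annihilator {F : Type*} [Field F] {m n k : ℕ} (D : Matrix (Fin m) (Fin n) F)
    (h : D.rank + k ≤ m) : ∃ M : Matrix (Fin k) (Fin m) F, M.rank = k ∧ M * D = 0 := by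
  have h1 := LinearMap.finrank_range_add_finrank_ker (Dᵀ.mulVecLin)
  have h2 : Module.finrank F (LinearMap.range Dᵀ.mulVecLin) = D.rank := by
    rw [← Matrix.rank_transpose D]; rfl
  rw [h2, Module.finrank_fin_fun] at h1
  obtain ⟨f, hf⟩ := exists_linearIndependent_of_le_finrank
    (R := F) (M := LinearMap.ker Dᵀ.mulVecLin) (n := k) (by omega)
  have hf' : LinearIndependent F (fun i => (f i : Fin m → F)) :=
    hf.map' (Submodule.subtype _) (Submodule.ker_subtype _)
  refine ⟨Matrix.of (fun i => (f i : Fin m → F)), ?_, ?_⟩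
  · simpa using LinearIndependent.rank_matrix (M := Matrix.of (fun i => (f i : Fin m → F))) hf'
  · ext i j
    have := congrFun (LinearMap.mem_ker.1 (f i).2) j
    simp only [Matrix.mulVecLin_apply, Matrix.mulVec_transpose] at this
    simpa [Matrix.mul_apply, Matrix.vecMul, dotProduct] using this

theorem aux_ncard_univ {F : Type*} [Field F] [Fintype F] (k n : ℕ) :
    (Set.univ : Set (Matrix (Fin k) (Fin n) F)).ncard = Fintype.card F ^ (k * n) := by
  classical
  rw [Set.ncard_univ]
  change Nat.card (Fin k → Fin n → F) = _
  rw [Nat.card_fun, Nat.card_fun, Nat.card_eq_fintype_card, Nat.card_eq_fintype_card,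
    Nat.card_eq_fintype_card, Fintype.card_fin, Fintype.card_fin, ← pow_mul, mul_comm]

theorem aux_dense_iff {F : Type*} [Field F] [Fintype F] {k m n : ℕ} (hkm : k ≤ m)
    (𝒜 : Set (Matrix (Fin m) (Fin n) F)) (hA : 𝒜.ncard = Fintype.card F ^ (k * n)) :
    IsKDense k 𝒜 ↔ ∀ X ∈ 𝒜, ∀ Y ∈ 𝒜, X ≠ Y → m - k + 1 ≤ (X - Y).rank := by
  constructor
  · intro h X hX Y hY hne
    by_contra hlt
    obtain ⟨M, hM, hMD⟩ := aux_exists_annihilator (k := k) (X - Y) (by omega)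
    have hinj : Set.InjOn (fun A => M * A) 𝒜 := by
      rw [← Set.ncard_image_iff (Set.toFinite _), h M hM, hA, aux_ncard_univ]
    refine hne (hinj hX hY ?_)
    rw [Matrix.mul_sub, sub_eq_zero] at hMD
    exact hMD
  · intro h M hM
    have hinj : Set.InjOn (fun A => M * A) 𝒜 := by
      intro X hX Y hY hXY
      by_contra hne
      have h1 := h X hX Y hY hne
      have h2 := Matrix.rank_add_rank_le_card_of_mul_eq_zero (A := M) (B := X - Y)
        (by rw [Matrix.mul_sub, sub_eq_zero]; exact hXY)
      rw [hM, Fintype.card_fin] at h2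
      omega
    apply Set.eq_of_subset_of_ncard_le (Set.subset_univ _)
    rw [hinj.ncard_image, hA, aux_ncard_univ]

/-- For `k ≤ m ≤ n`: (a) every `k`-dense subset of `F^{m×n}` has size at least `q^{kn}`;
(b) a subset of size `q^{kn}` is `k`-dense iff it is an `(m,n,k)` MRD code. Hence the
minimum size of a `k`-dense subset of `F^{m×n}` is `q^{kn}` when `m ≤ n`. -/
theorem stmt16 {F : Type*} [Field F] [Fintype F] [DecidableEq F] (q k m n : ℕ)
    (hq : Fintype.card F = q) (hk : 0 < k) (hkm : k ≤ m) (hmn : m ≤ n) :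
    (∀ 𝒜 : Set (Matrix (Fin m) (Fin n) F), IsKDense k 𝒜 → q ^ (k * n) ≤ 𝒜.ncard) ∧
      (∀ 𝒜 : Set (Matrix (Fin m) (Fin n) F), 𝒜.ncard = q ^ (k * n) →
        (IsKDense k 𝒜 ↔ IsMRD q k 𝒜)) := by
  subst hq
  have hq1 : 1 < Fintype.card F := Fintype.one_lt_card
  constructor
  · intro 𝒜 h
    obtain ⟨M, hM, -⟩ := aux_exists_annihilator (k := k) (0 : Matrix (Fin m) (Fin n) F)
      (by rw [Matrix.rank_zero]; omega)
    rw [← aux_ncard_univ, ← h M hM]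
    exact Set.ncard_image_le (Set.toFinite _)
  · intro 𝒜 hA
    rw [aux_dense_iff hkm 𝒜 hA, IsMRD, max_eq_right hmn, min_eq_left hmn]
    constructor
    · intro h
      refine ⟨hA, ?_⟩
      obtain ⟨M, hM, -⟩ := aux_exists_annihilator (k := k - 1) (0 : Matrix (Fin m) (Fin n) F)
        (by rw [Matrix.rank_zero]; omega)
      obtain ⟨X, hX, Y, hY, hne, hXY⟩ := Set.exists_ne_map_eq_of_ncard_lt_of_maps_to
        (s := 𝒜) (t := (Set.univ : Set (Matrix (Fin (k - 1)) (Fin n) F)))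
        (by
          rw [hA, aux_ncard_univ]
          exact Nat.pow_lt_pow_right hq1 (Nat.mul_lt_mul_of_pos_right (by omega) (by omega)))
        (f := fun A => M * A) (fun _ _ => Set.mem_univ _) (Set.toFinite _)
      have h2 := Matrix.rank_add_rank_le_card_of_mul_eq_zero (A := M) (B := X - Y)
        (by rw [Matrix.mul_sub, sub_eq_zero]; exact hXY)
      rw [hM, Fintype.card_fin] at h2
      apply le_antisymm
      · have h3 : rankDist 𝒜 ≤ (X - Y).rank := Nat.sInf_le ⟨X, hX, Y, hY, hne, rfl⟩
        omega
      · refine le_csInf ⟨_, X, hX, Y, hY, hne, rfl⟩ ?_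
        rintro r ⟨X, hX, Y, hY, hne, rfl⟩
        exact h X hX Y hY hne
    · rintro ⟨-, h⟩ X hX Y hY hne
      rw [← h]
      exact Nat.sInf_le ⟨X, hX, Y, hY, hne, rfl⟩
end
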